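/- (No rotation can beat the full basis.) Let W be a symmetric positive definite real ℓ×ℓ matrix, z ∈ ℝ^ℓ, B an ℓ×n real matrix with Bᵀ W⁻¹ B invertible, and Λ an n×n real matrix with Λᵀ Λ = I_n. Let (BΛ)_q denote the ℓ×q matrix consisting of the first q columns of BΛ (q ≤ n), and assume (BΛ)_qᵀ W⁻¹ (BΛ)_q is invertible. Then the truncated rotated basis cannot achieve a smaller reconstruction error than the full original basis: R_W((BΛ)_q, z) ≥ R_W(B, z). -/

import Mathlib

open Matrix

/-- The weighted quadratic form `‖v‖_W = vᵀ W⁻¹ v`. -/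
noncomputable def wNorm {l : ℕ} (W : Matrix (Fin l) (Fin l) ℝ) (v : Fin l → ℝ) : ℝ :=
  v ⬝ᵥ (W⁻¹ *ᵥ v)

/-- The weighted projection coefficients `ĉ(B,z) = (Bᵀ W⁻¹ B)⁻¹ Bᵀ W⁻¹ z`. -/
noncomputable def cHat {l k : ℕ} (W : Matrix (Fin l) (Fin l) ℝ)
    (B : Matrix (Fin l) (Fin k) ℝ) (z : Fin l → ℝ) : Fin k → ℝ :=
  ((Bᵀ * W⁻¹ * B)⁻¹ * Bᵀ * W⁻¹) *ᵥ z

/-- The weighted projection `P_B z = B ĉ(B,z)`. -/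
noncomputable def projW {l k : ℕ} (W : Matrix (Fin l) (Fin l) ℝ)
    (B : Matrix (Fin l) (Fin k) ℝ) (z : Fin l → ℝ) : Fin l → ℝ :=
  B *ᵥ cHat W B z

/-- The reconstruction error `R_W(B,z) = ‖z − P_B z‖_W`. -/
noncomputable def reconErr {l k : ℕ} (W : Matrix (Fin l) (Fin l) ℝ)
    (B : Matrix (Fin l) (Fin k) ℝ) (z : Fin l → ℝ) : ℝ :=
  wNorm W (z - projW W B z)

lemma reconErr_le_aux {l n : ℕ}
    (W : Matrix (Fin l) (Fin l) ℝ) (hW : W.PosDef)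
    (B : Matrix (Fin l) (Fin n) ℝ) (hB : IsUnit (Bᵀ * W⁻¹ * B))
    (z : Fin l → ℝ) (c : Fin n → ℝ) :
    reconErr W B z ≤ wNorm W (z - B *ᵥ c) := by
  have hWi : (W⁻¹).PosDef := hW.inv
  have hsymm : (W⁻¹)ᵀ = W⁻¹ := by
    have h := hWi.isHermitian.eq
    rwa [conjTranspose_eq_transpose_of_trivial] at h
  have hdet : IsUnit (Bᵀ * W⁻¹ * B).det := (Matrix.isUnit_iff_isUnit_det _).1 hB
  have horth : Bᵀ *ᵥ (W⁻¹ *ᵥ (z - projW W B z)) = 0 := by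
    have h1 : (Bᵀ * W⁻¹ * B) * ((Bᵀ * W⁻¹ * B)⁻¹ * Bᵀ * W⁻¹) = Bᵀ * W⁻¹ := by
      rw [Matrix.mul_assoc (Bᵀ * W⁻¹ * B)⁻¹, Matrix.mul_nonsing_inv_cancel_left _ _ hdet]
    unfold projW cHat
    rw [mulVec_mulVec, mulVec_sub, mulVec_mulVec, mulVec_mulVec, h1, sub_self]
  have hz : z - B *ᵥ c = (z - projW W B z) + B *ᵥ (cHat W B z - c) := by
    unfold projW
    rw [mulVec_sub]; abel
  unfold reconErr
  rw [hz]
  generalize z - projW W B z = r at *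
  generalize cHat W B z - c = d at *
  have hc1 : (B *ᵥ d) ⬝ᵥ (W⁻¹ *ᵥ r) = 0 := by
    rw [dotProduct_comm, dotProduct_mulVec, ← mulVec_transpose, horth, zero_dotProduct]
  have hc2 : r ⬝ᵥ (W⁻¹ *ᵥ (B *ᵥ d)) = 0 := by
    rw [dotProduct_mulVec, ← mulVec_transpose, hsymm, dotProduct_comm, hc1]
  have hn : 0 ≤ (B *ᵥ d) ⬝ᵥ (W⁻¹ *ᵥ (B *ᵥ d)) := by
    simpa using hWi.posSemidef.dotProduct_mulVec_nonneg (B *ᵥ d)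
  unfold wNorm
  rw [mulVec_add, dotProduct_add, add_dotProduct, add_dotProduct, hc1, hc2]
  linarith

/-- No rotation can beat the full basis: the reconstruction error of the first `q` columns
of a rotated basis `BΛ` is at least that of the full original basis `B`. -/
theorem reconErr_truncated_rotation_ge {l n q : ℕ}
    (W : Matrix (Fin l) (Fin l) ℝ) (hW : W.PosDef)
    (B : Matrix (Fin l) (Fin n) ℝ) (hB : IsUnit (Bᵀ * W⁻¹ * B))
    (Λ : Matrix (Fin n) (Fin n) ℝ) (hΛ : Λᵀ * Λ = 1)
    (hq : q ≤ n)
    (hBq : IsUnit (((B * Λ).submatrix id (Fin.castLE hq))ᵀ * W⁻¹ *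
      ((B * Λ).submatrix id (Fin.castLE hq))))
    (z : Fin l → ℝ) :
    reconErr W B z ≤ reconErr W ((B * Λ).submatrix id (Fin.castLE hq)) z := by
  have hsub : (B * Λ).submatrix id (Fin.castLE hq) = B * Λ.submatrix id (Fin.castLE hq) := by
    ext i j
    simp [Matrix.mul_apply]
  rw [hsub]
  have h := reconErr_le_aux W hW B hB z
    (Λ.submatrix id (Fin.castLE hq) *ᵥ cHat W (B * Λ.submatrix id (Fin.castLE hq)) z)
  rw [mulVec_mulVec] at h
  exact h
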